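/- Uniform second-difference bound for low-energy discrete curves (compactness estimate): Let ψ : ℝ → ℝ be continuously differentiable and 1-periodic, let C, σ, γ, c₀, S > 0, let ζ be a regularizer, and let N ≥ 1, h = 1/N, δ ≤ c₀·h, ρ > 0. Then every discrete curve v with |d_j| ≤ S for all j and E_{h,δ,ρ}[v] ≤ σ satisfies Σ_{j=1}^N D_j² · h ≤ (2/C)·(1 + S²)^{5/2}·[σ + 4γ·(∫₀¹ √(1 + ψ'(x)²) dx + c₀)]. -/

import Mathlib

open Filter MeasureTheory

noncomputable section

/-- mesh point `x_j = j·h` with `h = 1/N`. -/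
def xj (N : ℕ) (j : ℤ) : ℝ := j * ((1 : ℝ) / N)

/-- first difference quotient `d_j = (v_j − v_{j−1})/h`. -/
def dq (N : ℕ) (v : ℤ → ℝ) (j : ℤ) : ℝ := (v j - v (j - 1)) / ((1 : ℝ) / N)

/-- second difference quotient `D_j = (v_{j+1} − 2v_j + v_{j−1})/h²`. -/
def Dq (N : ℕ) (v : ℤ → ℝ) (j : ℤ) : ℝ :=
  (v (j + 1) - 2 * v j + v (j - 1)) / ((1 : ℝ) / N) ^ 2

/-- half segment length `l_j = (h/2)·√(1 + d_j²)`. -/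
def lq (N : ℕ) (v : ℤ → ℝ) (j : ℤ) : ℝ :=
  ((1 : ℝ) / N) / 2 * Real.sqrt (1 + dq N v j ^ 2)

/-- angle `θ_j` between consecutive segments. -/
def θq (N : ℕ) (v : ℤ → ℝ) (j : ℤ) : ℝ :=
  Real.arccos ((1 + dq N v j * dq N v (j + 1)) /
    (Real.sqrt (1 + dq N v j ^ 2) * Real.sqrt (1 + dq N v (j + 1) ^ 2)))

/-- discrete bending energy `B_h`. -/
def Bh (C : ℝ) (N : ℕ) (v : ℤ → ℝ) : ℝ :=
  C / 2 * ∑ j ∈ Finset.Icc (1 : ℤ) N, θq N v j ^ 2 *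
    ((lq N v j ^ 3 + lq N v (j + 1) ^ 3) /
      (lq N v j * lq N v (j + 1) * (lq N v j + lq N v (j + 1)) ^ 2))

/-- discrete tension `T_h`. -/
def Th (σ : ℝ) (N : ℕ) (v : ℤ → ℝ) : ℝ :=
  σ * ∑ j ∈ Finset.Icc (1 : ℤ) N, 2 * lq N v j

/-- a regularizer `ζ`. -/
def IsRegularizer (ζ : ℝ → ℝ) : Prop :=
  ContDiff ℝ 1 ζ ∧ (∀ t, 0 ≤ ζ t ∧ ζ t ≤ 1) ∧ (∀ t, ζ (-t) = ζ t) ∧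
    (∀ t, 1 < t → ζ t = 0) ∧ AntitoneOn ζ (Set.Icc 0 1) ∧ ζ 0 = 1

/-- discrete adhesion energy `A_{h,δ}` (with `ζ_δ(t) = ζ(t/δ)`). -/
def Ah (γ : ℝ) (ζ : ℝ → ℝ) (δ : ℝ) (ψ : ℝ → ℝ) (N : ℕ) (v : ℤ → ℝ) : ℝ :=
  γ * ∑ j ∈ Finset.Icc (1 : ℤ) N,
    ζ ((v (j - 1) - ψ (xj N (j - 1))) / δ) * ζ ((v j - ψ (xj N j)) / δ) * (2 * lq N v j)

/-- discrete penalty `P_{h,ρ}`. -/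
def Ph (ρ : ℝ) (ψ : ℝ → ℝ) (N : ℕ) (v : ℤ → ℝ) : ℝ :=
  1 / ρ * ∑ j ∈ Finset.Icc (1 : ℤ) N, max (ψ (xj N j) - v j) 0 ^ 2 * ((1 : ℝ) / N)

/-- total discrete energy `E_{h,δ,ρ}`. -/
def Eh (C σ γ : ℝ) (ζ ψ : ℝ → ℝ) (N : ℕ) (δ ρ : ℝ) (v : ℤ → ℝ) : ℝ :=
  Bh C N v + Th σ N v - Ah γ ζ δ ψ N v + Ph ρ ψ N v

/-- piecewise-affine interpolant of a discrete curve: on `[x_{j−1}, x_j]` it is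
`v_{j−1} + d_j·(x − x_{j−1})`. -/
def interp (N : ℕ) (v : ℤ → ℝ) (x : ℝ) : ℝ :=
  v (⌈x * N⌉ - 1) + dq N v ⌈x * N⌉ * (x - xj N (⌈x * N⌉ - 1))

/-- slope step function of a discrete curve: equal to `d_j` on `(x_{j−1}, x_j)`. -/
def slopeFn (N : ℕ) (v : ℤ → ℝ) (x : ℝ) : ℝ := dq N v ⌈x * N⌉

/-- The angle between the directions `(1, a)` and `(1, b)` dominates its sine. -/
theorem sq_sub_div_le_arccos_sq (a b : ℝ) :
    (a - b) ^ 2 / ((1 + a ^ 2) * (1 + b ^ 2)) ≤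
      Real.arccos ((1 + a * b) / (Real.sqrt (1 + a ^ 2) * Real.sqrt (1 + b ^ 2))) ^ 2 := by
  set c := (1 + a * b) / (Real.sqrt (1 + a ^ 2) * Real.sqrt (1 + b ^ 2)) with hc
  have hA : 0 < 1 + a ^ 2 := by positivity
  have hB : 0 < 1 + b ^ 2 := by positivity
  have hsq : 1 - c ^ 2 = (a - b) ^ 2 / ((1 + a ^ 2) * (1 + b ^ 2)) := by
    rw [hc, div_pow, mul_pow, Real.sq_sqrt hA.le, Real.sq_sqrt hB.le]
    field_simp
    ring
  have h1 : 0 ≤ 1 - c ^ 2 := by rw [hsq]; positivity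
  have h2 : Real.sqrt (1 - c ^ 2) ≤ Real.arccos c := by
    rw [← Real.sin_arccos]
    exact Real.sin_le (Real.arccos_nonneg c)
  rw [← hsq, ← Real.sq_sqrt h1]
  gcongr

/-- The bending weight is at least the reciprocal of the length bound. -/
theorem inv_le_bending_weight {h K L M : ℝ} (hh : 0 < h) (hL : 0 < L) (hM : 0 < M)
    (hLK : L ≤ K) (hMK : M ≤ K) :
    1 / (h * K) ≤ ((h / 2 * L) ^ 3 + (h / 2 * M) ^ 3) /
      ((h / 2 * L) * (h / 2 * M) * (h / 2 * L + h / 2 * M) ^ 2) := by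
  have hK : 0 < K := hL.trans_le hLK
  have heq : ((h / 2 * L) ^ 3 + (h / 2 * M) ^ 3) /
      ((h / 2 * L) * (h / 2 * M) * (h / 2 * L + h / 2 * M) ^ 2) =
      2 * (L ^ 2 - L * M + M ^ 2) / (h * (L * M * (L + M))) := by
    have : L + M ≠ 0 := by positivity
    have : h / 2 * L + h / 2 * M = h / 2 * (L + M) := by ring
    rw [this]
    field_simp
    ring
  rw [heq, div_le_div_iff₀ (by positivity) (by positivity)]
  have h1 : L * M ≤ L ^ 2 - L * M + M ^ 2 := by nlinarith [sq_nonneg (L - M)]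
  have h2 : L * M * (L + M) ≤ (L ^ 2 - L * M + M ^ 2) * (K + K) := by
    have : 0 ≤ L * M := by positivity
    exact mul_le_mul h1 (by linarith) (by positivity) (by linarith)
  nlinarith

/-- The length of a chord of a graph is at most the length of the graph. -/
theorem chord_le_integral_sqrt {ψ : ℝ → ℝ} (hψ : ContDiff ℝ 1 ψ) {a b : ℝ} (hab : a < b) :
    (b - a) * Real.sqrt (1 + ((ψ b - ψ a) / (b - a)) ^ 2) ≤
      ∫ x in a..b, Real.sqrt (1 + deriv ψ x ^ 2) := by
  set m := (ψ b - ψ a) / (b - a) with hm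
  have hcont : Continuous (deriv ψ) := hψ.continuous_deriv le_rfl
  have hpos : 0 < Real.sqrt (1 + m ^ 2) := Real.sqrt_pos.2 (by positivity)
  have hba : 0 < b - a := sub_pos.2 hab
  have hFTC : ∫ x in a..b, deriv ψ x = ψ b - ψ a :=
    intervalIntegral.integral_deriv_eq_sub
      (fun x _ => (hψ.differentiable one_ne_zero).differentiableAt)
      (hcont.intervalIntegrable a b)
  have hint : ∫ x in a..b, (1 + m * deriv ψ x) / Real.sqrt (1 + m ^ 2) =
      (b - a) * Real.sqrt (1 + m ^ 2) := by
    rw [intervalIntegral.integral_div, intervalIntegral.integral_add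
      (by simp) ((hcont.const_mul m).intervalIntegrable a b),
      intervalIntegral.integral_const_mul, hFTC, intervalIntegral.integral_const,
      div_eq_iff hpos.ne', mul_assoc, Real.mul_self_sqrt (by positivity)]
    have : ψ b - ψ a = m * (b - a) := by rw [hm]; field_simp
    rw [this, smul_eq_mul]
    ring
  rw [← hint]
  refine intervalIntegral.integral_mono_on hab.le
    (Continuous.intervalIntegrable (by fun_prop) a b)
    (Continuous.intervalIntegrable (by fun_prop) a b) fun x _ => ?_
  rw [div_le_iff₀ hpos, ← Real.sqrt_mul (by positivity)]
  apply Real.le_sqrt_of_sq_le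
  nlinarith [sq_nonneg (deriv ψ x - m)]

/-- `p ↦ √(1 + p²)` is 1-Lipschitz. -/
theorem sqrt_one_add_sq_le (p q : ℝ) :
    Real.sqrt (1 + p ^ 2) ≤ Real.sqrt (1 + q ^ 2) + |p - q| := by
  have h1 : |q| ≤ Real.sqrt (1 + q ^ 2) := Real.abs_le_sqrt (by linarith)
  apply Real.sqrt_le_iff.2 ⟨by positivity, ?_⟩
  have h2 : q * (p - q) ≤ Real.sqrt (1 + q ^ 2) * |p - q| :=
    (le_abs_self _).trans (by rw [abs_mul]; gcongr)
  nlinarith [Real.sq_sqrt (show 0 ≤ 1 + q ^ 2 by positivity), sq_abs (p - q)]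

theorem IsRegularizer.eq_zero_of_one_lt_abs {ζ : ℝ → ℝ} (hζ : IsRegularizer ζ) {t : ℝ}
    (ht : 1 < |t|) : ζ t = 0 := by
  obtain ⟨-, -, heven, hzero, -⟩ := hζ
  rcases lt_abs.1 ht with h | h
  · exact hzero t h
  · rw [← heven, hzero _ h]

theorem lq_pos {N : ℕ} (hN : 1 ≤ N) (v : ℤ → ℝ) (j : ℤ) : 0 < lq N v j := by
  unfold lq
  have : (0 : ℝ) < N := by exact_mod_cast hN
  have : 0 < Real.sqrt (1 + dq N v j ^ 2) := Real.sqrt_pos.2 (by positivity)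
  positivity

theorem xj_sub_xj_sub_one (N : ℕ) (j : ℤ) : xj N j - xj N (j - 1) = 1 / N := by
  unfold xj
  push_cast
  ring

/-- A segment whose endpoints are `δ`-close to the obstacle is not much longer than the
obstacle beneath it. -/
theorem two_mul_lq_le {ψ : ℝ → ℝ} (hψ : ContDiff ℝ 1 ψ) {N : ℕ} (hN : 1 ≤ N) {δ c₀ : ℝ}
    (hδ : δ ≤ c₀ * ((1 : ℝ) / N)) {v : ℤ → ℝ} {j : ℤ}
    (h₁ : |v (j - 1) - ψ (xj N (j - 1))| ≤ δ) (h₂ : |v j - ψ (xj N j)| ≤ δ) :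
    2 * lq N v j ≤ (∫ x in xj N (j - 1)..xj N j, Real.sqrt (1 + deriv ψ x ^ 2)) +
      2 * c₀ * ((1 : ℝ) / N) := by
  have hN' : (0 : ℝ) < N := by exact_mod_cast hN
  have hx := xj_sub_xj_sub_one N j
  have hh : (0 : ℝ) < 1 / N := by positivity
  have hchord := chord_le_integral_sqrt hψ (a := xj N (j - 1)) (b := xj N j) (by linarith)
  rw [hx] at hchord
  unfold lq dq
  set h : ℝ := 1 / N with hhdef
  set d := (v j - v (j - 1)) / h with hd
  set m := (ψ (xj N j) - ψ (xj N (j - 1))) / h with hm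
  have hdm : |d - m| ≤ 2 * c₀ := by
    rw [hd, hm, ← sub_div, abs_div, abs_of_pos hh, div_le_iff₀ hh]
    rw [abs_le] at h₁ h₂ ⊢
    constructor <;> linarith
  have hlip := sqrt_one_add_sq_le d m
  calc 2 * (h / 2 * Real.sqrt (1 + d ^ 2)) = h * Real.sqrt (1 + d ^ 2) := by ring
    _ ≤ h * (Real.sqrt (1 + m ^ 2) + 2 * c₀) := by gcongr; linarith
    _ ≤ _ := by linarith

theorem sum_integral_xj {f : ℝ → ℝ} (hf : Continuous f) {N : ℕ} (hN : 1 ≤ N) :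
    ∑ j ∈ Finset.Icc (1 : ℤ) N, ∫ x in xj N (j - 1)..xj N j, f x = ∫ x in Set.Ioo 0 1, f x := by
  have hN' : (N : ℝ) ≠ 0 := by
    have : N ≠ 0 := by omega
    exact_mod_cast this
  have hsum : ∑ j ∈ Finset.Icc (1 : ℤ) N, ∫ x in xj N (j - 1)..xj N j, f x =
      ∑ k ∈ Finset.range N, ∫ x in xj N (k : ℤ)..xj N ((k + 1 : ℕ) : ℤ), f x := by
    refine Finset.sum_nbij' (fun j => (j - 1).toNat) (fun k => (k : ℤ) + 1) ?_ ?_ ?_ ?_ ?_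
    · intro j hj
      simp only [Finset.mem_Icc, Finset.mem_range] at *
      omega
    · intro k hk
      simp only [Finset.mem_Icc, Finset.mem_range] at *
      omega
    · intro j hj
      simp only [Finset.mem_Icc] at *
      omega
    · intro k hk
      simp
    · intro j hj
      simp only [Finset.mem_Icc] at hj
      have h1 : ((j - 1).toNat : ℤ) = j - 1 := by omega
      have h2 : (((j - 1).toNat + 1 : ℕ) : ℤ) = j := by omega
      rw [h1, h2]
  rw [hsum, intervalIntegral.sum_integral_adjacent_intervals (a := fun k : ℕ => xj N (k : ℤ))
    fun k _ => hf.intervalIntegrable _ _]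
  have h0 : xj N ((0 : ℕ) : ℤ) = 0 := by simp [xj]
  have h1 : xj N ((N : ℕ) : ℤ) = 1 := by simp [xj, hN']
  rw [h0, h1, intervalIntegral.integral_of_le zero_le_one, integral_Ioc_eq_integral_Ioo]

/-- The adhesion energy is bounded by the length of the obstacle. -/
theorem Ah_le {ψ : ℝ → ℝ} (hψ : ContDiff ℝ 1 ψ) {γ c₀ : ℝ} (hγ : 0 ≤ γ) (hc₀ : 0 ≤ c₀)
    {ζ : ℝ → ℝ} (hζ : IsRegularizer ζ) {N : ℕ} (hN : 1 ≤ N) {δ : ℝ} (hδpos : 0 < δ)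
    (hδ : δ ≤ c₀ * ((1 : ℝ) / N)) (v : ℤ → ℝ) :
    Ah γ ζ δ ψ N v ≤
      γ * ((∫ x in Set.Ioo (0 : ℝ) 1, Real.sqrt (1 + deriv ψ x ^ 2)) + 2 * c₀) := by
  have hN' : (0 : ℝ) < N := by exact_mod_cast hN
  have hcont : Continuous (deriv ψ) := hψ.continuous_deriv le_rfl
  unfold Ah
  refine mul_le_mul_of_nonneg_left ?_ hγ
  have hterm : ∀ j ∈ Finset.Icc (1 : ℤ) N,
      ζ ((v (j - 1) - ψ (xj N (j - 1))) / δ) * ζ ((v j - ψ (xj N j)) / δ) * (2 * lq N v j) ≤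
      (∫ x in xj N (j - 1)..xj N j, Real.sqrt (1 + deriv ψ x ^ 2)) +
        2 * c₀ * ((1 : ℝ) / N) := by
    intro j _
    have hl := lq_pos hN v j
    have hx := xj_sub_xj_sub_one N j
    have hh : (0 : ℝ) < 1 / N := by positivity
    have hnonneg : 0 ≤ (∫ x in xj N (j - 1)..xj N j, Real.sqrt (1 + deriv ψ x ^ 2)) +
        2 * c₀ * ((1 : ℝ) / N) :=
      add_nonneg (intervalIntegral.integral_nonneg (by linarith) fun x _ => Real.sqrt_nonneg _)
        (by positivity)
    by_cases h₁ : |v (j - 1) - ψ (xj N (j - 1))| ≤ δ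
    · by_cases h₂ : |v j - ψ (xj N j)| ≤ δ
      · refine le_trans ?_ (two_mul_lq_le hψ hN hδ h₁ h₂)
        exact mul_le_of_le_one_left (by positivity)
          (mul_le_one₀ (hζ.2.1 _).2 (hζ.2.1 _).1 (hζ.2.1 _).2)
      · rw [hζ.eq_zero_of_one_lt_abs (t := (v j - ψ (xj N j)) / δ)
          (by rw [abs_div, abs_of_pos hδpos, one_lt_div hδpos]; exact not_le.1 h₂)]
        simpa using hnonneg
    · rw [hζ.eq_zero_of_one_lt_abs (t := (v (j - 1) - ψ (xj N (j - 1))) / δ)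
        (by rw [abs_div, abs_of_pos hδpos, one_lt_div hδpos]; exact not_le.1 h₁)]
      simpa using hnonneg
  refine (Finset.sum_le_sum hterm).trans (le_of_eq ?_)
  rw [Finset.sum_add_distrib, sum_integral_xj (by fun_prop) hN]
  simp only [Finset.sum_const, Int.card_Icc, nsmul_eq_mul]
  have : ((N : ℤ) + 1 - 1).toNat = N := by omega
  rw [this]
  field_simp

/-- The bending energy controls the second differences of curves with bounded slopes. -/
theorem le_Bh {C : ℝ} (hC : 0 < C) {N : ℕ} (hN : 1 ≤ N) {S : ℝ} {v : ℤ → ℝ}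
    (hd : ∀ j, |dq N v j| ≤ S) :
    C / 2 * ∑ j ∈ Finset.Icc (1 : ℤ) (N : ℤ), Dq N v j ^ 2 * ((1 : ℝ) / N) ≤
      Real.sqrt (1 + S ^ 2) ^ 5 * Bh C N v := by
  have hN' : (0 : ℝ) < N := by exact_mod_cast hN
  have hh : (0 : ℝ) < 1 / N := by positivity
  set K := Real.sqrt (1 + S ^ 2) with hK
  have hKpos : 0 < K := Real.sqrt_pos.2 (by positivity)
  have hK2 : K ^ 2 = 1 + S ^ 2 := Real.sq_sqrt (by positivity)
  have hS2 : ∀ j, 1 + dq N v j ^ 2 ≤ 1 + S ^ 2 := fun j => by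
    have := pow_le_pow_left₀ (abs_nonneg _) (hd j) 2
    rw [sq_abs] at this
    linarith
  unfold Bh
  rw [mul_left_comm]
  refine mul_le_mul_of_nonneg_left ?_ (by positivity)
  rw [Finset.mul_sum]
  refine Finset.sum_le_sum fun j _ => ?_
  have hangle : (dq N v j - dq N v (j + 1)) ^ 2 / (K ^ 2 * K ^ 2) ≤ θq N v j ^ 2 := by
    refine le_trans ?_ (sq_sub_div_le_arccos_sq (dq N v j) (dq N v (j + 1)))
    rw [hK2]
    exact div_le_div_of_nonneg_left (sq_nonneg _) (by positivity)
      (mul_le_mul (hS2 _) (hS2 _) (by positivity) (by positivity))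
  have hweight := inv_le_bending_weight hh
    (Real.sqrt_pos.2 (by positivity : 0 < 1 + dq N v j ^ 2))
    (Real.sqrt_pos.2 (by positivity : 0 < 1 + dq N v (j + 1) ^ 2))
    (Real.sqrt_le_sqrt (hS2 j)) (Real.sqrt_le_sqrt (hS2 (j + 1)))
  have hD : dq N v j - dq N v (j + 1) = -(Dq N v j * (1 / N)) := by
    unfold dq Dq
    rw [add_sub_cancel_right]
    field_simp
    ring
  have hprod := mul_le_mul hangle hweight (by positivity) (by positivity)
  calc Dq N v j ^ 2 * ((1 : ℝ) / N)
      = K ^ 5 * ((dq N v j - dq N v (j + 1)) ^ 2 / (K ^ 2 * K ^ 2) * (1 / (1 / N * K))) := by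
        rw [hD]
        field_simp
    _ ≤ _ := by
        unfold lq
        gcongr

/-- Uniform second-difference bound for low-energy discrete curves
(compactness estimate). -/
theorem stmt14 (ψ : ℝ → ℝ) (hψ : ContDiff ℝ 1 ψ) (hψper : ∀ x, ψ (x + 1) = ψ x)
    (C σ γ c₀ S : ℝ) (hC : 0 < C) (hσ : 0 < σ) (hγ : 0 < γ) (hc₀ : 0 < c₀) (hS : 0 < S)
    (ζ : ℝ → ℝ) (hζ : IsRegularizer ζ)
    (N : ℕ) (hN : 1 ≤ N) (δ ρ : ℝ) (hδpos : 0 < δ) (hδ : δ ≤ c₀ * ((1 : ℝ) / N))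
    (hρ : 0 < ρ)
    (v : ℤ → ℝ) (hper : ∀ j, v (j + N) = v j) (hd : ∀ j, |dq N v j| ≤ S)
    (hE : Eh C σ γ ζ ψ N δ ρ v ≤ σ) :
    ∑ j ∈ Finset.Icc (1 : ℤ) (N : ℤ), Dq N v j ^ 2 * ((1 : ℝ) / N) ≤
      2 / C * (1 + S ^ 2) ^ ((5 : ℝ) / 2) *
        (σ + 4 * γ * ((∫ x in Set.Ioo (0 : ℝ) 1, Real.sqrt (1 + deriv ψ x ^ 2)) + c₀)) := by
  have hN' : (0 : ℝ) < N := by exact_mod_cast hN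
  have hA := Ah_le hψ hγ.le hc₀.le hζ hN hδpos hδ v
  have hB := le_Bh hC hN hd
  set I := ∫ x in Set.Ioo (0 : ℝ) 1, Real.sqrt (1 + deriv ψ x ^ 2)
  have hI : 0 ≤ I := integral_nonneg fun x => Real.sqrt_nonneg _
  have hT : 0 ≤ Th σ N v :=
    mul_nonneg hσ.le (Finset.sum_nonneg fun j _ => by have := lq_pos hN v j; positivity)
  have hP : 0 ≤ Ph ρ ψ N v :=
    mul_nonneg (by positivity) (Finset.sum_nonneg fun j _ => by positivity)
  have hBle : Bh C N v ≤ σ + 4 * γ * (I + c₀) := by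
    unfold Eh at hE
    nlinarith [mul_nonneg hγ.le hI, mul_nonneg hγ.le hc₀.le]
  have hpow : (1 + S ^ 2) ^ ((5 : ℝ) / 2) = Real.sqrt (1 + S ^ 2) ^ 5 := by
    rw [Real.sqrt_eq_rpow, ← Real.rpow_mul_natCast (by positivity)]
    norm_num
  rw [hpow]
  set X := ∑ j ∈ Finset.Icc (1 : ℤ) (N : ℤ), Dq N v j ^ 2 * ((1 : ℝ) / N)
  calc X = 2 / C * (C / 2 * X) := by field_simp
    _ ≤ 2 / C * (Real.sqrt (1 + S ^ 2) ^ 5 * (σ + 4 * γ * (I + c₀))) := by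
        refine mul_le_mul_of_nonneg_left (hB.trans ?_) (by positivity)
        gcongr
    _ = _ := by ring

end
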